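/- arXiv:1812.04256 — 6 statements merged into one kernel-verified Lean document; each statement's English description precedes it below -/
import Mathlib

section
/- Let m ≥ 1 and n ≥ 1 be natural numbers. Let ν ∈ ℝ^m, ν ≠ 0, c ∈ ℝ, and let H = {x ∈ ℝ^m : ⟨x, ν⟩ = c} be an affine hyperplane of codimension 1. Let ι : ℝ^{m−1} → ℝ^m be an injective affine map whose image is exactly H. Suppose P = P_1 ∪ P_2 ⊆ ℝ^m where: (i) P_1 = ι(S) for a set S ⊆ ℝ^{m−1} with |S| = binom(m−1+n, n) such that no nonzero polynomial in m−1 variables of total degree at most n vanishes at every point of S; and (ii) P_2 ⊆ ℝ^m with P_2 ∩ H = ∅, |P_2| = binom(m+n−1, n−1), and no nonzero polynomial in m variables of total degree at most n−1 vanishes at every point of P_2. Then no nonzero polynomial in m variables of total degree at most n vanishes at every point of P; i.e., P is unisolvent with respect to (m,n). -/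
open MvPolynomial

/-- Substituting polynomials of degree at most one does not increase the total degree. -/
theorem MvPolynomial.totalDegree_bind₁_le_of_forall_le_one {σ τ R : Type*} [CommSemiring R]
    (f : σ → MvPolynomial τ R) (hf : ∀ i, (f i).totalDegree ≤ 1) (Q : MvPolynomial σ R) :
    (bind₁ f Q).totalDegree ≤ Q.totalDegree := by
  rw [bind₁, aeval_def, eval₂_eq]
  refine totalDegree_finsetSum_le fun d hd => ?_
  refine (totalDegree_mul _ _).trans ?_
  rw [algebraMap_eq, totalDegree_C, zero_add]
  refine (totalDegree_finsetProd _ _).trans (le_trans ?_ (le_totalDegree hd))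
  refine Finset.sum_le_sum fun i _ => (totalDegree_pow _ _).trans ?_
  simpa using Nat.mul_le_mul_left (d i) (hf i)

theorem MvPolynomial.eval_bind₁ {σ τ R : Type*} [CommSemiring R]
    (f : σ → MvPolynomial τ R) (x : τ → R) (Q : MvPolynomial σ R) :
    eval x (bind₁ f Q) = eval (fun i => eval x (f i)) Q :=
  eval₂Hom_bind₁ _ _ _ _

/-- A real polynomial vanishing on an affine hyperplane is divisible by the defining equation. -/
theorem MvPolynomial.dvd_of_eval_eq_zero_on_hyperplane {σ : Type*} [Fintype σ]
    {ν : σ → ℝ} (hν : ν ≠ 0) (c : ℝ) (Q : MvPolynomial σ ℝ)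
    (hQ : ∀ x : σ → ℝ, ∑ i, x i * ν i = c → eval x Q = 0) :
    (∑ i, X i * C (ν i) - C c : MvPolynomial σ ℝ) ∣ Q := by
  set L : MvPolynomial σ ℝ := ∑ i, X i * C (ν i) - C c with hL
  have hs : ∑ i, ν i * ν i ≠ 0 := fun h => hν (dotProduct_self_eq_zero.mp h)
  set s : ℝ := ∑ i, ν i * ν i with hsdef
  let f : σ → MvPolynomial σ ℝ := fun i => X i - C (ν i / s) * L
  have hLe (x : σ → ℝ) : eval x L = ∑ i, x i * ν i - c := by simp [hL]
  have hzero : bind₁ f Q = 0 := by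
    refine MvPolynomial.funext fun x => ?_
    rw [map_zero, eval_bind₁]
    refine hQ _ ?_
    simp only [f, map_sub, map_mul, eval_X, eval_C, hLe, sub_mul, Finset.sum_sub_distrib]
    have : ∑ i, ν i / s * (∑ i, x i * ν i - c) * ν i = s * ((∑ i, x i * ν i - c) / s) := by
      rw [hsdef, Finset.sum_mul]
      refine Finset.sum_congr rfl fun i _ => by ring
    rw [this, mul_div_cancel₀ _ hs]
    ring
  have hmk : (Ideal.Quotient.mkₐ ℝ (Ideal.span {L})).comp (bind₁ f) =
      Ideal.Quotient.mkₐ ℝ (Ideal.span {L}) := by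
    refine algHom_ext fun i => ?_
    simp only [AlgHom.comp_apply, bind₁_X_right, Ideal.Quotient.mkₐ_eq_mk]
    rw [Ideal.Quotient.eq, Ideal.mem_span_singleton]
    exact ⟨-C (ν i / s), by simp only [f]; ring⟩
  have h := DFunLike.congr_fun hmk Q
  rw [AlgHom.comp_apply, hzero, map_zero, Ideal.Quotient.mkₐ_eq_mk] at h
  exact Ideal.mem_span_singleton.mp (Ideal.Quotient.eq_zero_iff_mem.mp h.symm)

/-- The defining equation of an affine hyperplane is not constant. -/
theorem MvPolynomial.one_le_totalDegree_hyperplane {σ : Type*} [Fintype σ]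
    {ν : σ → ℝ} (hν : ν ≠ 0) (c : ℝ) :
    1 ≤ (∑ i, X i * C (ν i) - C c : MvPolynomial σ ℝ).totalDegree := by
  by_contra! h
  obtain ⟨a, ha⟩ : ∃ a, (∑ i, X i * C (ν i) - C c : MvPolynomial σ ℝ) = C a :=
    ⟨_, totalDegree_eq_zero_iff_eq_C.mp (Nat.lt_one_iff.mp h)⟩
  have h0 := congrArg (eval 0) ha
  have h1 := congrArg (eval ν) ha
  simp only [map_sub, map_sum, map_mul, eval_X, eval_C, Pi.zero_apply, zero_mul,
    Finset.sum_const_zero] at h0 h1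
  exact hν (dotProduct_self_eq_zero.mp (show ∑ i, ν i * ν i = 0 by linarith))

/-- An affine map between coordinate spaces is given by polynomials of degree at most one. -/
theorem AffineMap.exists_mvPolynomial_totalDegree_le_one {σ τ : Type*} [Fintype τ]
    (g : (τ → ℝ) →ᵃ[ℝ] (σ → ℝ)) :
    ∃ f : σ → MvPolynomial τ ℝ, (∀ i, (f i).totalDegree ≤ 1) ∧
      ∀ x, (fun i => eval x (f i)) = g x := by
  classical
  refine ⟨fun i => ∑ j, X j * C (g.linear (fun k => if j = k then 1 else 0) i) + C (g 0 i),
    fun i => ?_, fun x => ?_⟩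
  · refine (totalDegree_add _ _).trans (max_le ?_ (by simp))
    refine totalDegree_finsetSum_le fun j _ => ?_
    exact (totalDegree_mul _ _).trans (by simp)
  · ext i
    have h := congrFun (congrFun g.decomp x) i
    rw [h, Pi.add_apply, Pi.add_apply, LinearMap.pi_apply_eq_sum_univ g.linear x]
    simp [Finset.sum_apply]

/-- Decomposition theorem for unisolvent node sets: if `H = {x : ⟨x,ν⟩ = c}` is an affine
hyperplane (parametrized by an injective affine map `ι : ℝ^{m-1} → ℝ^m` with range `H`),
`P₁ = ι(S)` for a set `S` of `binom(m-1+n, n)` points unisolvent in `m-1` variables of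
degree `n`, and `P₂` is a set of `binom(m+n-1, n-1)` points disjoint from `H` which is
unisolvent for degree `n-1`, then `P = P₁ ∪ P₂` is unisolvent with respect to `(m,n)`. -/
theorem unisolvent_of_hyperplane_decomposition
    (m n : ℕ) (hm : 1 ≤ m) (hn : 1 ≤ n)
    (ν : Fin m → ℝ) (hν : ν ≠ 0) (c : ℝ)
    (ι : (Fin (m - 1) → ℝ) →ᵃ[ℝ] (Fin m → ℝ)) (hι : Function.Injective ⇑ι)
    (hιrange : Set.range ⇑ι = {x : Fin m → ℝ | ∑ i, x i * ν i = c})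
    (S : Set (Fin (m - 1) → ℝ)) (hSfin : S.Finite)
    (hScard : S.ncard = (m - 1 + n).choose n)
    (hSuni : ∀ Q : MvPolynomial (Fin (m - 1)) ℝ, Q.totalDegree ≤ n →
      (∀ s ∈ S, eval s Q = 0) → Q = 0)
    (P₂ : Set (Fin m → ℝ)) (hP₂fin : P₂.Finite)
    (hP₂card : P₂.ncard = (m + n - 1).choose (n - 1))
    (hP₂H : ∀ q ∈ P₂, ∑ i, q i * ν i ≠ c)
    (hP₂uni : ∀ Q : MvPolynomial (Fin m) ℝ, Q.totalDegree ≤ n - 1 →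
      (∀ q ∈ P₂, eval q Q = 0) → Q = 0) :
    ∀ Q : MvPolynomial (Fin m) ℝ, Q.totalDegree ≤ n →
      (∀ q ∈ (⇑ι '' S) ∪ P₂, eval q Q = 0) → Q = 0 := by
  intro Q hQdeg hQ
  obtain ⟨f, hf, hfι⟩ := ι.exists_mvPolynomial_totalDegree_le_one
  have heval (x : Fin (m - 1) → ℝ) : eval x (bind₁ f Q) = eval (ι x) Q := by
    rw [eval_bind₁, hfι]
  have hpull : bind₁ f Q = 0 :=
    hSuni _ ((totalDegree_bind₁_le_of_forall_le_one f hf Q).trans hQdeg) fun s hs => by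
      rw [heval]
      exact hQ _ (Or.inl ⟨s, hs, rfl⟩)
  have hH (x : Fin m → ℝ) (hx : ∑ i, x i * ν i = c) : eval x Q = 0 := by
    obtain ⟨y, rfl⟩ : x ∈ Set.range ι := hιrange ▸ hx
    rw [← heval, hpull, map_zero]
  obtain ⟨R, rfl⟩ := dvd_of_eval_eq_zero_on_hyperplane hν c Q hH
  have hL := one_le_totalDegree_hyperplane hν c
  by_cases hR : R = 0
  · rw [hR, mul_zero]
  have hL0 : (∑ i, X i * C (ν i) - C c : MvPolynomial (Fin m) ℝ) ≠ 0 := by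
    intro h
    simp [h] at hL
  rw [totalDegree_mul_of_isDomain hL0 hR] at hQdeg
  refine absurd (hP₂uni R (by omega) fun q hq => ?_) hR
  have h := hQ q (Or.inr hq)
  rw [map_mul] at h
  refine (mul_eq_zero.mp h).resolve_left ?_
  simpa [sub_eq_zero] using hP₂H q hq
end

section
/- For all natural numbers m ≥ 1 and n there exists a finite set P ⊆ ℝ^m with |P| = binom(m+n, n) such that for every function f : ℝ^m → ℝ there is exactly one polynomial Q in m variables of total degree at most n with Q(p) = f(p) for all p ∈ P. -/
open MvPolynomial Module

theorem card_finsupp_degree_le (m n : ℕ) :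
    Nat.card {s : Fin m →₀ ℕ | (s.sum fun _ e => e) ≤ n} = (m + n).choose n := by
  classical
  have hset : {s : Fin m →₀ ℕ | (s.sum fun _ e => e) ≤ n} =
      ((Finset.range (n + 1)).biUnion fun k =>
        Finset.finsuppAntidiag (Finset.univ : Finset (Fin m)) k : Finset (Fin m →₀ ℕ)) := by
    ext s
    simp [Finset.mem_finsuppAntidiag, Finsupp.sum_fintype]
  rw [hset, Nat.card_coe_set_eq, Set.ncard_coe_finset, Finset.card_biUnion]
  · simp only [Finset.card_finsuppAntidiag_nat_eq_multichoose, Finset.card_univ, Fintype.card_fin]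
    rw [Nat.sum_range_multichoose, add_comm n m]
    exact Nat.choose_symm_add
  · intro i _ j _ hij
    refine Finset.disjoint_left.mpr fun s hi hj => ?_
    exact hij ((Finset.mem_finsuppAntidiag.mp hi).1.symm.trans (Finset.mem_finsuppAntidiag.mp hj).1)

theorem finrank_restrictTotalDegree (K : Type*) [Field K] (m n : ℕ) :
    finrank K (restrictTotalDegree (Fin m) K n) = (m + n).choose n := by
  rw [← card_finsupp_degree_le]
  exact finrank_eq_nat_card_basis (basisRestrictSupport K _)

/-- If a family of linear forms separates the elements of a finite-dimensional space `V`, then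
some `finrank K V` of its members can be assigned arbitrary values, each assignment being attained
at a unique element of `V`. -/
theorem exists_finset_card_eq_finrank_existsUnique {K X V : Type*} [Field K] [AddCommGroup V]
    [Module K V] [FiniteDimensional K V] (ev : X → Dual K V)
    (hev : ∀ v, (∀ x, ev x v = 0) → v = 0) :
    ∃ P : Finset X, P.card = finrank K V ∧
      ∀ f : X → K, ∃! v : V, ∀ p ∈ P, ev p v = f p := by
  classical
  have hspan : Submodule.span K (Set.range ev) = ⊤ := by
    rw [← Subspace.dualCoannihilator_dualAnnihilator_eq (W := Submodule.span K (Set.range ev)),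
      show (Submodule.span K (Set.range ev)).dualCoannihilator = ⊥ from ?_,
      Submodule.dualAnnihilator_bot]
    rw [eq_bot_iff]
    intro v hv
    rw [Submodule.mem_dualCoannihilator] at hv
    exact hev v fun x => hv _ (Submodule.subset_span ⟨x, rfl⟩)
  obtain ⟨g, hg, hgspan, hgli⟩ := Submodule.exists_fun_fin_finrank_span_eq K (Set.range ev)
  choose q hq using hg
  have hd : finrank K (Submodule.span K (Set.range ev)) = finrank K V := by
    rw [hspan, finrank_top, Subspace.dual_finrank_eq]
  have hqinj : Function.Injective q := fun i j hij =>
    hgli.injective (by rw [← hq i, ← hq j, hij])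
  let L : V →ₗ[K] (Fin (finrank K (Submodule.span K (Set.range ev))) → K) := LinearMap.pi g
  have hLinj : Function.Injective L := by
    rw [injective_iff_map_eq_zero]
    intro v hv
    refine hev v fun x => ?_
    have hx : ev x ∈ Submodule.span K (Set.range g) := by
      rw [hgspan]
      exact Submodule.subset_span ⟨x, rfl⟩
    generalize ev x = φ at hx ⊢
    induction hx using Submodule.span_induction with
    | mem φ h => obtain ⟨i, rfl⟩ := h; exact congrFun hv i
    | zero => rfl
    | add φ ψ _ _ h₁ h₂ => simp [h₁, h₂]
    | smul c φ _ h => simp [h]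
  have hLsurj : Function.Surjective L :=
    (LinearMap.injective_iff_surjective_of_finrank_eq_finrank (by simp [hd])).mp hLinj
  refine ⟨Finset.univ.image q, ?_, fun f => ?_⟩
  · rw [Finset.card_image_of_injective _ hqinj, Finset.card_univ, Fintype.card_fin, hd]
  · have key : ∀ v : V, (∀ p ∈ Finset.univ.image q, ev p v = f p) ↔ L v = f ∘ q := by
      intro v
      simp [_root_.funext_iff, L, hq]
    simp only [key]
    exact Function.Bijective.existsUnique ⟨hLinj, hLsurj⟩ _

/-- For all `m ≥ 1` and `n` there exists a finite set `P ⊆ ℝ^m` with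
`|P| = binom(m+n, n)` such that every function `f : ℝ^m → ℝ` has exactly one interpolating
polynomial in `m` variables of total degree at most `n` on `P` (i.e. `P` is unisolvent). -/
theorem exists_unisolvent_nodes (m n : ℕ) (hm : 1 ≤ m) :
    ∃ P : Finset (Fin m → ℝ), P.card = (m + n).choose n ∧
      ∀ f : (Fin m → ℝ) → ℝ, ∃! Q : MvPolynomial (Fin m) ℝ,
        Q.totalDegree ≤ n ∧ ∀ p ∈ P, MvPolynomial.eval p Q = f p := by
  have hfin : FiniteDimensional ℝ (restrictTotalDegree (Fin m) ℝ n) :=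
    FiniteDimensional.of_finrank_pos <| by
      rw [finrank_restrictTotalDegree]
      exact Nat.choose_pos (Nat.le_add_left n m)
  obtain ⟨P, hP, hex⟩ := exists_finset_card_eq_finrank_existsUnique
    (V := restrictTotalDegree (Fin m) ℝ n)
    (fun x : Fin m → ℝ => (aeval x).toLinearMap ∘ₗ (restrictTotalDegree (Fin m) ℝ n).subtype)
    (fun v hv => Subtype.ext (MvPolynomial.funext fun x => by
      simpa [aeval_eq_eval] using hv x))
  refine ⟨P, hP.trans (finrank_restrictTotalDegree ℝ m n), fun f => ?_⟩
  obtain ⟨v, hv, huniq⟩ := hex f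
  refine ⟨v, ⟨(mem_restrictTotalDegree _ _ _).mp v.2, fun p hp => ?_⟩, fun Q hQ => ?_⟩
  · simpa [aeval_eq_eval] using hv p hp
  · exact congrArg Subtype.val (huniq ⟨Q, (mem_restrictTotalDegree _ _ _).mpr hQ.1⟩
      fun p hp => by simpa [aeval_eq_eval] using hQ.2 p hp)
end

section
/- Let m ≥ 1 and n be natural numbers. For each i = 1, …, m let p_{i,0}, p_{i,1}, …, p_{i,n} ∈ ℝ be pairwise distinct real numbers, and for each multi-index α ∈ ℕ^m with |α| := α_1 + ⋯ + α_m ≤ n define the node q_α := (p_{1,α_1}, …, p_{m,α_m}) ∈ ℝ^m and the multivariate Newton polynomial N_α(x) := ∏_{i=1}^m ∏_{j=0}^{α_i − 1} (x_i − p_{i,j}). Then for every function f : ℝ^m → ℝ there exist uniquely determined coefficients c_α ∈ ℝ, for α ∈ ℕ^m with |α| ≤ n, such that the polynomial Q(x) = Σ_{|α| ≤ n} c_α N_α(x) satisfies Q(q_β) = f(q_β) for every multi-index β with |β| ≤ n. In particular, the node set {q_α : |α| ≤ n} is unisolvent: Q is the unique polynomial of total degree at most n interpolating f on these nodes. -/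
open MvPolynomial

/-- Multi-indices `α ∈ ℕ^m` with `|α| ≤ n`, encoded with entries in `Fin (n+1)`. -/
abbrev NewtonIdx (m n : ℕ) : Type := {α : Fin m → Fin (n + 1) // (∑ i, (α i : ℕ)) ≤ n}

/-- The canonical multidimensional Newton node `q_α = (p_{1,α_1},…,p_{m,α_m})`. -/
def newtonNode (m n : ℕ) (p : Fin m → ℕ → ℝ) (α : NewtonIdx m n) : Fin m → ℝ :=
  fun i => p i (α.1 i : ℕ)

/-- The multivariate Newton polynomial
`N_α(x) = ∏_{i=1}^m ∏_{j=0}^{α_i - 1} (x_i - p_{i,j})`. -/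
noncomputable def newtonPoly (m n : ℕ) (p : Fin m → ℕ → ℝ) (α : NewtonIdx m n) :
    MvPolynomial (Fin m) ℝ :=
  ∏ i, ∏ j ∈ Finset.range (α.1 i : ℕ), (X i - C (p i j))

/-- The coordinatewise natural-number exponent of a multi-index, as a finitely supported function. -/
noncomputable def newtonExponent {m n : ℕ} (α : NewtonIdx m n) : Fin m →₀ ℕ :=
  Finsupp.equivFunOnFinite.symm fun i => (α.1 i : ℕ)

theorem eval_newtonPoly (m n : ℕ) (p : Fin m → ℕ → ℝ) (α : NewtonIdx m n) (x : Fin m → ℝ) :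
    eval x (newtonPoly m n p α) =
      ∏ i, ∏ j ∈ Finset.range (α.1 i : ℕ), (x i - p i j) := by
  simp [newtonPoly]

theorem eval_newtonNode_newtonPoly_eq_zero {m n : ℕ} (p : Fin m → ℕ → ℝ) {α β : NewtonIdx m n}
    (h : ¬ α.1 ≤ β.1) : eval (newtonNode m n p β) (newtonPoly m n p α) = 0 := by
  obtain ⟨i, hi⟩ := not_forall.1 h
  rw [eval_newtonPoly]
  refine Finset.prod_eq_zero (Finset.mem_univ i) ?_
  exact Finset.prod_eq_zero (Finset.mem_range.2 (Fin.lt_def.1 (not_le.1 hi))) (sub_self _)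

theorem eval_newtonNode_newtonPoly_self_ne_zero {m n : ℕ} {p : Fin m → ℕ → ℝ}
    (hp : ∀ i : Fin m, ∀ j ≤ n, ∀ k ≤ n, p i j = p i k → j = k) (β : NewtonIdx m n) :
    eval (newtonNode m n p β) (newtonPoly m n p β) ≠ 0 := by
  rw [eval_newtonPoly]
  refine Finset.prod_ne_zero_iff.2 fun i _ => Finset.prod_ne_zero_iff.2 fun j hj h => ?_
  have hj := Finset.mem_range.1 hj
  have hβ : (β.1 i : ℕ) ≤ n := Nat.lt_succ_iff.1 (β.1 i).isLt
  exact hj.ne' (hp i _ hβ j (hj.le.trans hβ) (sub_eq_zero.1 h))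

theorem totalDegree_newtonPoly_le (m n : ℕ) (p : Fin m → ℕ → ℝ) (α : NewtonIdx m n) :
    (newtonPoly m n p α).totalDegree ≤ n := by
  refine (totalDegree_finsetProd _ _).trans (le_trans (Finset.sum_le_sum fun i _ => ?_) α.2)
  refine (totalDegree_finsetProd _ _).trans ?_
  refine (Finset.sum_le_card_nsmul _ _ 1 fun j _ => ?_).trans (by simp)
  exact (totalDegree_sub_C_le _ _).trans (totalDegree_X _).le

/-- Evaluation of polynomials at all the Newton nodes. -/
noncomputable def newtonEval (m n : ℕ) (p : Fin m → ℕ → ℝ) :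
    MvPolynomial (Fin m) ℝ →ₗ[ℝ] NewtonIdx m n → ℝ :=
  LinearMap.pi fun β => (aeval (newtonNode m n p β)).toLinearMap

theorem newtonEval_apply (m n : ℕ) (p : Fin m → ℕ → ℝ) (Q : MvPolynomial (Fin m) ℝ)
    (β : NewtonIdx m n) : newtonEval m n p Q β = eval (newtonNode m n p β) Q := by
  simp [newtonEval, aeval_eq_eval]

theorem newtonEval_linearCombination_injective {m n : ℕ} {p : Fin m → ℕ → ℝ}
    (hp : ∀ i : Fin m, ∀ j ≤ n, ∀ k ≤ n, p i j = p i k → j = k) :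
    Function.Injective
      (newtonEval m n p ∘ₗ Fintype.linearCombination ℝ (newtonPoly m n p)) := by
  refine (injective_iff_map_eq_zero _).2 fun c hc => funext fun β => ?_
  induction β using WellFoundedLT.induction with
  | ind β ih =>
    have h := congrFun hc β
    simp only [LinearMap.comp_apply, newtonEval_apply, Fintype.linearCombination_apply, map_sum,
      smul_eval, Pi.zero_apply] at h
    rw [Finset.sum_eq_single β] at h
    · exact (mul_eq_zero.1 h).resolve_right (eval_newtonNode_newtonPoly_self_ne_zero hp β)
    · intro α _ hα
      by_cases hle : α ≤ β
      · rw [ih α (lt_of_le_of_ne hle hα), Pi.zero_apply, zero_mul]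
      · rw [eval_newtonNode_newtonPoly_eq_zero p hle, mul_zero]
    · exact fun hβ => (hβ (Finset.mem_univ β)).elim

theorem exists_linearCombination_monomial_eq {m n : ℕ} {Q : MvPolynomial (Fin m) ℝ}
    (hQ : Q.totalDegree ≤ n) :
    ∃ d, Fintype.linearCombination ℝ
      (fun α : NewtonIdx m n => monomial (newtonExponent α) (1 : ℝ)) d = Q := by
  rw [← LinearMap.mem_range, Fintype.range_linearCombination, ← support_sum_monomial_coeff Q]
  refine Submodule.sum_mem _ fun s hs => ?_
  have hsum : ∑ i, s i ≤ n := by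
    have h := (le_totalDegree hs).trans hQ
    rwa [Finsupp.sum_fintype _ _ fun _ => rfl] at h
  have hle (i : Fin m) : s i ≤ n :=
    (Finset.single_le_sum (fun _ _ => Nat.zero_le _) (Finset.mem_univ i)).trans hsum
  have hmem := Submodule.smul_mem _ (coeff s Q) (Submodule.subset_span (R := ℝ)
    (Set.mem_range_self (f := fun α : NewtonIdx m n => monomial (newtonExponent α) (1 : ℝ))
      ⟨fun i => ⟨s i, Nat.lt_succ_iff.2 (hle i)⟩, hsum⟩))
  have hs' : newtonExponent (⟨fun i => ⟨s i, Nat.lt_succ_iff.2 (hle i)⟩, hsum⟩ :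
      NewtonIdx m n) = s := by
    ext i
    rfl
  simpa only [hs', smul_monomial, smul_eq_mul, mul_one] using hmem

theorem totalDegree_linearCombination_newtonPoly_le {m n : ℕ} (p : Fin m → ℕ → ℝ)
    (c : NewtonIdx m n → ℝ) :
    (Fintype.linearCombination ℝ (newtonPoly m n p) c).totalDegree ≤ n := by
  rw [Fintype.linearCombination_apply]
  exact totalDegree_finsetSum_le fun α _ =>
    (totalDegree_smul_le _ _).trans (totalDegree_newtonPoly_le m n p α)

theorem newtonEval_injOn {m n : ℕ} {p : Fin m → ℕ → ℝ}
    (hp : ∀ i : Fin m, ∀ j ≤ n, ∀ k ≤ n, p i j = p i k → j = k) :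
    Set.InjOn (newtonEval m n p) {Q | Q.totalDegree ≤ n} := by
  have hsurj : Function.Surjective (newtonEval m n p ∘ₗ Fintype.linearCombination ℝ
      (fun α : NewtonIdx m n => monomial (newtonExponent α) (1 : ℝ))) := by
    intro y
    obtain ⟨c, rfl⟩ := LinearMap.injective_iff_surjective.1
      (newtonEval_linearCombination_injective hp) y
    obtain ⟨d, hd⟩ := exists_linearCombination_monomial_eq
      (totalDegree_linearCombination_newtonPoly_le p c)
    exact ⟨d, by simp only [LinearMap.comp_apply, hd]⟩
  intro P hP Q hQ h
  obtain ⟨d, rfl⟩ := exists_linearCombination_monomial_eq hP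
  obtain ⟨e, rfl⟩ := exists_linearCombination_monomial_eq hQ
  exact congrArg _ (LinearMap.injective_iff_surjective.2 hsurj h)

/-- For pairwise distinct nodes `p_{i,0},…,p_{i,n}` in each coordinate, every function
`f : ℝ^m → ℝ` admits uniquely determined coefficients `c_α` such that
`Q = Σ_{|α| ≤ n} c_α N_α` interpolates `f` at all the canonical multidimensional Newton
nodes `q_β`, `|β| ≤ n`; in particular these nodes are unisolvent: `Q` is the unique
polynomial of total degree at most `n` interpolating `f` there. -/
theorem newton_nodes_interpolation
    (m n : ℕ) (hm : 1 ≤ m)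
    (p : Fin m → ℕ → ℝ)
    (hp : ∀ i : Fin m, ∀ j ≤ n, ∀ k ≤ n, p i j = p i k → j = k)
    (f : (Fin m → ℝ) → ℝ) :
    (∃! c : NewtonIdx m n → ℝ,
      ∀ β : NewtonIdx m n,
        eval (newtonNode m n p β)
            (∑ α : NewtonIdx m n, C (c α) * newtonPoly m n p α) =
          f (newtonNode m n p β)) ∧
    (∃! Q : MvPolynomial (Fin m) ℝ, Q.totalDegree ≤ n ∧
      ∀ β : NewtonIdx m n,
        eval (newtonNode m n p β) Q = f (newtonNode m n p β)) := by
  have hinj := newtonEval_linearCombination_injective hp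
  have hsum (c : NewtonIdx m n → ℝ) : ∑ α : NewtonIdx m n, C (c α) * newtonPoly m n p α =
      Fintype.linearCombination ℝ (newtonPoly m n p) c := by
    simp only [Fintype.linearCombination_apply, smul_eq_C_mul]
  have heval (Q : MvPolynomial (Fin m) ℝ) :
      (∀ β : NewtonIdx m n, eval (newtonNode m n p β) Q = f (newtonNode m n p β)) ↔
        newtonEval m n p Q = fun β => f (newtonNode m n p β) := by
    simp only [funext_iff, newtonEval_apply]
  simp only [hsum, heval]
  obtain ⟨c, hc⟩ := LinearMap.injective_iff_surjective.1 hinj fun β => f (newtonNode m n p β)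
  have hdeg := totalDegree_linearCombination_newtonPoly_le p c
  exact ⟨⟨c, hc, fun c' hc' => hinj (hc'.trans hc.symm)⟩,
    ⟨_, ⟨hdeg, hc⟩, fun Q hQ => newtonEval_injOn hp hQ.1 hdeg (hQ.2.trans hc.symm)⟩⟩
end

section
/- Let m ≥ 1 and n be natural numbers, and for each i = 1, …, m let p_{i,0}, …, p_{i,n} ∈ ℝ be pairwise distinct. For multi-indices α, β ∈ ℕ^m with |α| ≤ n and |β| ≤ n, let q_β := (p_{1,β_1}, …, p_{m,β_m}) and N_α(x) := ∏_{i=1}^m ∏_{j=0}^{α_i − 1}(x_i − p_{i,j}). Then N_α(q_β) ≠ 0 if and only if α_i ≤ β_i for all i = 1, …, m; in particular N_α(q_α) ≠ 0, and N_α(q_β) = 0 whenever β_i < α_i for some i. Consequently, the matrix (N_α(q_β))_{β,α} is triangular with nonzero diagonal with respect to any linear order extending the componentwise partial order on multi-indices. -/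
open MvPolynomial

theorem eval_newtonNode_newtonPoly_ne_zero_iff (m n : ℕ) (p : Fin m → ℕ → ℝ)
    (hp : ∀ i : Fin m, ∀ j ≤ n, ∀ k ≤ n, p i j = p i k → j = k) (α β : NewtonIdx m n) :
    eval (newtonNode m n p β) (newtonPoly m n p α) ≠ 0 ↔
      ∀ i, (α.1 i : ℕ) ≤ (β.1 i : ℕ) := by
  simp only [eval_newtonPoly, newtonNode, Finset.prod_ne_zero_iff, Finset.mem_univ,
    forall_true_left, Finset.mem_range, sub_ne_zero]
  refine forall_congr' fun i => ⟨fun h => ?_, fun h j hj heq => ?_⟩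
  · by_contra! hlt
    exact h _ hlt rfl
  · have := hp i _ (Fin.is_le (β.1 i)) j (hj.le.trans (Fin.is_le (α.1 i))) heq
    omega

/-- For pairwise distinct nodes in each coordinate: `N_α(q_β) ≠ 0` iff `α_i ≤ β_i` for all
`i`; in particular `N_α(q_α) ≠ 0` and `N_α(q_β) = 0` whenever `β_i < α_i` for some `i`.
Consequently, with respect to any linear order (encoded by an enumeration `ord`) extending
the componentwise partial order on multi-indices, the matrix `(N_α(q_β))_{β,α}` is
triangular with nonzero diagonal. -/
theorem newton_poly_triangular
    (m n : ℕ) (hm : 1 ≤ m)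
    (p : Fin m → ℕ → ℝ)
    (hp : ∀ i : Fin m, ∀ j ≤ n, ∀ k ≤ n, p i j = p i k → j = k) :
    (∀ α β : NewtonIdx m n,
      eval (newtonNode m n p β) (newtonPoly m n p α) ≠ 0 ↔
        ∀ i, (α.1 i : ℕ) ≤ (β.1 i : ℕ)) ∧
    (∀ α : NewtonIdx m n, eval (newtonNode m n p α) (newtonPoly m n p α) ≠ 0) ∧
    (∀ α β : NewtonIdx m n, (∃ i, (β.1 i : ℕ) < (α.1 i : ℕ)) →
      eval (newtonNode m n p β) (newtonPoly m n p α) = 0) ∧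
    (∀ ord : NewtonIdx m n → ℕ, Function.Injective ord →
      (∀ α β : NewtonIdx m n, α ≠ β → (∀ i, (α.1 i : ℕ) ≤ (β.1 i : ℕ)) →
        ord α < ord β) →
      ∀ α β : NewtonIdx m n, ord β < ord α →
        eval (newtonNode m n p β) (newtonPoly m n p α) = 0) := by
  have key := eval_newtonNode_newtonPoly_ne_zero_iff m n p hp
  refine ⟨key, fun α => (key α α).2 fun i => le_rfl, ?_, ?_⟩
  · rintro α β ⟨i, hi⟩
    by_contra h
    exact hi.not_ge ((key α β).1 h i)
  · intro ord _ hord α β hlt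
    by_contra h
    have hne : α ≠ β := by
      rintro rfl
      exact hlt.false
    exact hlt.asymm (hord α β hne ((key α β).1 h))
end

section
/- Let m ≥ 1 and n be natural numbers, and for each i = 1, …, m let p_{i,0}, …, p_{i,n} ∈ ℝ be pairwise distinct. Then the multivariate Newton polynomials N_α(x) := ∏_{i=1}^m ∏_{j=0}^{α_i − 1}(x_i − p_{i,j}), for multi-indices α ∈ ℕ^m with |α| ≤ n, are linearly independent over ℝ and form a basis of the space Π_{m,n} of polynomials in m variables of total degree at most n. -/
open MvPolynomial

/-- The product `∏ i, ∏ j < α i, (X i - p i j)` for an arbitrary multi-index `α`. -/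
noncomputable def newtonProd {σ R : Type*} [Fintype σ] [CommRing R] (p : σ → ℕ → R)
    (α : σ → ℕ) : MvPolynomial σ R :=
  ∏ i, ∏ j ∈ Finset.range (α i), (X i - C (p i j))

section newtonProd

variable {σ R : Type*} [Fintype σ] [CommRing R] (p : σ → ℕ → R)

theorem newtonProd_add_single [DecidableEq σ] (α : σ → ℕ) (i : σ) :
    newtonProd p (α + Pi.single i 1) = newtonProd p α * (X i - C (p i (α i))) := by
  unfold newtonProd
  rw [← Finset.mul_prod_erase _ _ (Finset.mem_univ i),
    ← Finset.mul_prod_erase Finset.univ (fun k => ∏ j ∈ Finset.range (α k), _)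
      (Finset.mem_univ i)]
  have h : ∏ k ∈ Finset.univ.erase i, ∏ j ∈ Finset.range ((α + Pi.single i 1 : σ → ℕ) k),
      (X k - C (p k j)) =
        ∏ k ∈ Finset.univ.erase i, ∏ j ∈ Finset.range (α k), (X k - C (p k j)) :=
    Finset.prod_congr rfl fun k hk => by simp [Finset.ne_of_mem_erase hk]
  rw [h]
  simp only [Pi.add_apply, Pi.single_eq_same, Finset.prod_range_succ]
  ring

theorem totalDegree_newtonProd_le (α : σ → ℕ) :
    (newtonProd p α).totalDegree ≤ ∑ i, α i := by
  rcases subsingleton_or_nontrivial R with _ | _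
  · simp [Subsingleton.elim (newtonProd p α) 0]
  refine (totalDegree_finsetProd _ _).trans (Finset.sum_le_sum fun i _ => ?_)
  refine (totalDegree_finsetProd _ _).trans ?_
  refine (Finset.sum_le_card_nsmul _ _ 1 fun j _ => ?_).trans (by simp)
  exact (totalDegree_sub_C_le _ _).trans (totalDegree_X i).le

theorem newtonProd_mul_X_mem_span {k : ℕ} {f : MvPolynomial σ R}
    (hf : f ∈ Submodule.span R (newtonProd p '' {α | ∑ i, α i ≤ k})) (i : σ) :
    f * X i ∈ Submodule.span R (newtonProd p '' {α | ∑ i, α i ≤ k + 1}) := by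
  classical
  induction hf using Submodule.span_induction with
  | mem f hf =>
    obtain ⟨α, hα, rfl⟩ := hf
    rw [Set.mem_ofPred_eq] at hα
    have h : newtonProd p α * X i =
        newtonProd p (α + Pi.single i 1) + p i (α i) • newtonProd p α := by
      rw [newtonProd_add_single, smul_eq_C_mul]
      ring
    rw [h]
    refine add_mem (Submodule.subset_span ⟨_, ?_, rfl⟩)
      (Submodule.smul_mem _ _ (Submodule.subset_span ⟨_, ?_, rfl⟩))
    · simp [Finset.sum_add_distrib, hα]
    · exact hα.trans k.le_succ
  | zero => simp
  | add f g _ _ hf hg => rw [add_mul]; exact add_mem hf hg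
  | smul a f _ hf => rw [smul_mul_assoc]; exact Submodule.smul_mem _ _ hf

theorem monomial_mem_span_newtonProd (s : σ →₀ ℕ) :
    monomial s (1 : R) ∈ Submodule.span R (newtonProd p '' {α | ∑ i, α i ≤ s.degree}) := by
  induction hk : s.degree generalizing s with
  | zero =>
    obtain rfl := (Finsupp.degree_eq_zero_iff s).mp hk
    exact Submodule.subset_span ⟨0, by simp, by simp [newtonProd]⟩
  | succ k ih =>
    obtain ⟨i, hi⟩ : ∃ i, s i ≠ 0 := by
      by_contra! h
      simp [Finsupp.degree_eq_sum, h] at hk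
    have hs : s - Finsupp.single i 1 + Finsupp.single i 1 = s :=
      tsub_add_cancel_of_le (Finsupp.single_le_iff.mpr (Nat.one_le_iff_ne_zero.mpr hi))
    have hd : (s - Finsupp.single i 1).degree = k := by
      have := congrArg Finsupp.degree hs
      rw [map_add, Finsupp.degree_single, hk] at this
      omega
    rw [← hs, monomial_add_single, pow_one]
    exact newtonProd_mul_X_mem_span p (ih _ hd) i

theorem span_newtonProd (n : ℕ) :
    Submodule.span R (newtonProd p '' {α | ∑ i, α i ≤ n}) = restrictTotalDegree σ R n := by
  apply le_antisymm
  · rw [Submodule.span_le]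
    rintro _ ⟨α, hα, rfl⟩
    exact (mem_restrictTotalDegree _ _ _).mpr ((totalDegree_newtonProd_le p α).trans hα)
  · rw [restrictTotalDegree, restrictSupport_eq_span, Submodule.span_le]
    rintro _ ⟨s, hs, rfl⟩
    have hs' : s.degree ≤ n := hs
    exact Submodule.span_mono (Set.image_mono fun α hα => hα.trans hs')
      (monomial_mem_span_newtonProd p s)

end newtonProd

/-- Multi-indices with entries in `Fin (n + 1)` are the exponents of total degree at most `n`. -/
noncomputable def newtonIdxEquiv (m n : ℕ) :
    NewtonIdx m n ≃ {s : Fin m →₀ ℕ | (s.sum fun _ e => e) ≤ n} where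
  toFun α := ⟨Finsupp.equivFunOnFinite.symm fun i => α.1 i, by
    simpa [Finsupp.sum_fintype] using α.2⟩
  invFun s := ⟨fun i => ⟨s.1 i, Nat.lt_succ_of_le <|
      (Finset.single_le_sum (fun _ _ => Nat.zero_le _) (Finset.mem_univ i)).trans
        ((Finsupp.sum_fintype s.1 (fun _ e => e) fun _ => rfl).ge.trans s.2)⟩,
    (Finsupp.sum_fintype s.1 (fun _ e => e) fun _ => rfl).ge.trans s.2⟩
  left_inv α := by ext; simp
  right_inv s := by ext; simp

theorem range_newtonPoly (m n : ℕ) (p : Fin m → ℕ → ℝ) :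
    Set.range (newtonPoly m n p) = newtonProd p '' {α | ∑ i, α i ≤ n} := by
  ext f
  constructor
  · rintro ⟨α, rfl⟩
    exact ⟨fun i => α.1 i, α.2, rfl⟩
  · rintro ⟨α, hα, rfl⟩
    exact ⟨⟨fun i => ⟨α i, Nat.lt_succ_of_le <|
      (Finset.single_le_sum (fun _ _ => Nat.zero_le _) (Finset.mem_univ i)).trans hα⟩, hα⟩, rfl⟩

/-- For pairwise distinct nodes `p_{i,0},…,p_{i,n}` in each coordinate, the multivariate
Newton polynomials `N_α`, `|α| ≤ n`, are linearly independent over `ℝ` and form a basis of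
the space `Π_{m,n}` of polynomials of total degree at most `n` (they span it). -/
theorem newton_polys_basis
    (m n : ℕ) (hm : 1 ≤ m)
    (p : Fin m → ℕ → ℝ)
    (hp : ∀ i : Fin m, ∀ j ≤ n, ∀ k ≤ n, p i j = p i k → j = k) :
    LinearIndependent ℝ (newtonPoly m n p) ∧
      Submodule.span ℝ (Set.range (newtonPoly m n p)) =
        MvPolynomial.restrictTotalDegree (Fin m) ℝ n := by
  have hspan : Submodule.span ℝ (Set.range (newtonPoly m n p)) =
      restrictTotalDegree (Fin m) ℝ n := by
    rw [range_newtonPoly, span_newtonProd]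
  refine ⟨?_, hspan⟩
  rw [linearIndependent_iff_card_eq_finrank_span, Set.finrank, hspan, ← Nat.card_eq_fintype_card,
    Nat.card_congr (newtonIdxEquiv m n)]
  exact (Module.finrank_eq_nat_card_basis (basisRestrictSupport ℝ _)).symm
end

section
/- Let n be a natural number, p_1, …, p_{n+1} ∈ ℝ pairwise distinct, and f : ℝ → ℝ. Define the alternative scheme coefficients by f_0 := f, f_k(x) := (f_{k−1}(x) − f_{k−1}(p_k))/(x − p_k) for x ∉ {p_1, …, p_k}, c_0 := f_0(p_1), c_k := f_k(p_{k+1}). Define the classical divided differences by [p_i]f := f(p_i) and [p_i, …, p_j]f := ([p_{i+1}, …, p_j]f − [p_i, …, p_{j−1}]f)/(p_j − p_i) for i < j. Then c_k = [p_1, …, p_{k+1}]f for every k = 0, …, n; i.e., the alternative divided difference scheme and the classical divided difference scheme compute the same Newton coefficients. -/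
/-- The alternative divided difference scheme: `f_0 = f` and
`f_{k+1}(x) = (f_k(x) - f_k(p_k)) / (x - p_k)` (nodes indexed from `0`). -/
noncomputable def altScheme (p : ℕ → ℝ) (f : ℝ → ℝ) : ℕ → ℝ → ℝ
  | 0 => f
  | k + 1 => fun x => (altScheme p f k x - altScheme p f k (p k)) / (x - p k)

/-- The classical divided differences: `classicalDD p f i l = [p_i, …, p_{i+l}]f`, defined
by `[p_i]f = f(p_i)` and
`[p_i, …, p_j]f = ([p_{i+1}, …, p_j]f - [p_i, …, p_{j-1}]f) / (p_j - p_i)`. -/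
noncomputable def classicalDD (p : ℕ → ℝ) (f : ℝ → ℝ) : ℕ → ℕ → ℝ
  | i, 0 => f (p i)
  | i, l + 1 =>
      (classicalDD p f (i + 1) l - classicalDD p f i l) / (p (i + l + 1) - p i)

/-- Removing the first node from the alternative scheme: it satisfies the recursion of the
classical divided differences. -/
theorem altScheme_succ_eq_shift (p : ℕ → ℝ) (f : ℝ → ℝ) (k : ℕ)
    (hp : Set.InjOn p (Set.Iic k)) (x : ℝ) (hx : ∀ i ≤ k, x ≠ p i) :
    altScheme p f (k + 1) x =
      (altScheme (fun i => p (i + 1)) f k x - altScheme p f k (p k)) / (x - p 0) := by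
  induction k generalizing x with
  | zero => rfl
  | succ k ih =>
    have hp' : Set.InjOn p (Set.Iic k) := hp.mono (Set.Iic_subset_Iic.2 k.le_succ)
    have hq : ∀ i ≤ k, p (k + 1) ≠ p i := fun i hi h => by
      have := hp (Set.mem_Iic.2 le_rfl) (Set.mem_Iic.2 (by omega)) h
      omega
    have h1 := sub_ne_zero.2 (hx 0 (by omega))
    have h2 := sub_ne_zero.2 (hx (k + 1) le_rfl)
    have h3 := sub_ne_zero.2 (hq 0 (by omega))
    have hA := ih hp' x (fun i hi => hx i (by omega))
    have hB := ih hp' (p (k + 1)) hq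
    have hC : altScheme (fun i => p (i + 1)) f (k + 1) x =
        (altScheme (fun i => p (i + 1)) f k x - altScheme (fun i => p (i + 1)) f k (p (k + 1)))
          / (x - p (k + 1)) := rfl
    have hD : altScheme p f (k + 1 + 1) x =
        (altScheme p f (k + 1) x - altScheme p f (k + 1) (p (k + 1))) / (x - p (k + 1)) := rfl
    rw [hD, hC, hA, hB]
    field_simp
    ring

/-- The classical divided difference over `p_s, …, p_{s+l}` is computed by the alternative
scheme for the nodes shifted by `s`. -/
theorem classicalDD_eq_altScheme_shift (p : ℕ → ℝ) (f : ℝ → ℝ) (l s : ℕ)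
    (hp : Set.InjOn p (Set.Iic (s + l))) :
    classicalDD p f s l = altScheme (fun i => p (s + i)) f l (p (s + l)) := by
  induction l generalizing s with
  | zero => rfl
  | succ l ih =>
    have hinj : Set.InjOn (fun i => p (s + i)) (Set.Iic l) := fun i hi j hj h => by
      simp only [Set.mem_Iic] at hi hj
      have := hp (Set.mem_Iic.2 (by omega)) (Set.mem_Iic.2 (by omega)) h
      omega
    have hx : ∀ i ≤ l, p (s + (l + 1)) ≠ p (s + i) := fun i hi h => by
      have := hp (Set.mem_Iic.2 (by omega)) (Set.mem_Iic.2 (by omega)) h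
      omega
    rw [altScheme_succ_eq_shift (fun i => p (s + i)) f l hinj _ hx, classicalDD,
      ih s (hp.mono (Set.Iic_subset_Iic.2 (by omega))),
      ih (s + 1) (hp.mono (Set.Iic_subset_Iic.2 (by omega)))]
    simp only [add_assoc, add_comm 1, add_zero]

/-- For pairwise distinct nodes `p_0, …, p_n`, the coefficients `c_k = f_k(p_k)` computed
by the alternative divided difference scheme agree with the classical divided differences
`[p_0, …, p_k]f` for all `k ≤ n`. -/
theorem altScheme_eq_classicalDD (n : ℕ) (p : ℕ → ℝ)
    (hp : ∀ j ≤ n, ∀ k ≤ n, p j = p k → j = k) (f : ℝ → ℝ) :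
    ∀ k ≤ n, altScheme p f k (p k) = classicalDD p f 0 k := by
  intro k hk
  have h := classicalDD_eq_altScheme_shift p f k 0 (fun i hi j hj hij => by
    simp only [Set.mem_Iic] at hi hj
    exact hp i (by omega) j (by omega) hij)
  simpa only [zero_add] using h.symm
end
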